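/- Under hypotheses (H0)-(H3), the convergence norm of the transition kernel P equals ρ(P) = inf_{a ∈ ℝ^d} max(φ(a), φ₀(a)). -/

import Mathlib

open scoped Classical BigOperators
open Filter

noncomputable section

namespace RWHalfspace

/-- `ℤ^d` modeled as `ℤ^{d-1} × ℤ`; the Lean parameter `d` is the paper's `d-1`,
so that the paper's hypothesis `d ≥ 1` is automatic. -/
abbrev Zd (d : ℕ) := (Fin d → ℤ) × ℤ
/-- The state space `E = ℤ^{d-1} × ℕ`. -/
abbrev Ed (d : ℕ) := (Fin d → ℤ) × ℕ
/-- `ℝ^d` modeled as `ℝ^{d-1} × ℝ`. -/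
abbrev Rd (d : ℕ) := (Fin d → ℝ) × ℝ

variable {d : ℕ}

/-- The scalar product `a · z` for `a ∈ ℝ^d`, `z ∈ ℤ^d`. -/
def dotZ (a : Rd d) (z : Zd d) : ℝ := (∑ i, a.1 i * (z.1 i : ℝ)) + a.2 * (z.2 : ℝ)

/-- The scalar product on `ℝ^d`. -/
def dotR (a b : Rd d) : ℝ := (∑ i, a.1 i * b.1 i) + a.2 * b.2

/-- The scalar product `a · z` for `a ∈ ℝ^d`, `z ∈ E = ℤ^{d-1} × ℕ`. -/
def dotE (a : Rd d) (z : Ed d) : ℝ := (∑ i, a.1 i * (z.1 i : ℝ)) + a.2 * (z.2 : ℝ)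

/-- The jump generating function `φ(a) = ∑_{z ∈ ℤ^d} μ(z) e^{a·z}`. -/
def phi (μ : Zd d → ℝ) (a : Rd d) : ℝ := ∑' z, μ z * Real.exp (dotZ a z)

/-- The difference `z' - z ∈ ℤ^d` of two points of `E`. -/
def jump (z z' : Ed d) : Zd d := (z'.1 - z.1, (z'.2 : ℤ) - (z.2 : ℤ))

/-- The transition kernel of the reflected random walk on `E = ℤ^{d-1} × ℕ`. -/
def ker (μ μ₀ : Zd d → ℝ) (z z' : Ed d) : ℝ :=
  if z.2 = 0 then μ₀ (jump z z') else μ (jump z z')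

/-- The `n`-step transition kernel `p^(n)`. -/
def kerN (μ μ₀ : Zd d → ℝ) : ℕ → Ed d → Ed d → ℝ
  | 0 => fun z z' => if z = z' then 1 else 0
  | n + 1 => fun z z' => ∑' w, kerN μ μ₀ n z w * ker μ μ₀ w z'

/-- The `n`-step kernel of the homogeneous random walk on `ℤ^d` with step distribution `μ`. -/
def homN (μ : Zd d → ℝ) : ℕ → Zd d → Zd d → ℝ
  | 0 => fun z z' => if z = z' then 1 else 0
  | n + 1 => fun z z' => ∑' w, homN μ n z w * μ (z' - w)

/-- The step distribution of the last coordinate of the homogeneous random walk. -/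
def lastStep (μ : Zd d → ℝ) (k : ℤ) : ℝ := ∑' x : Fin d → ℤ, μ (x, k)

/-- The `n`-step kernel of the last coordinate random walk on `ℤ`. -/
def lastN (μ : Zd d → ℝ) : ℕ → ℤ → ℤ → ℝ
  | 0 => fun k k' => if k = k' then 1 else 0
  | n + 1 => fun k k' => ∑' j, lastN μ n k j * lastStep μ (k' - j)

/-- The convergence norm `ρ(P) = limsup_n (p^(n)(z,z'))^{1/n}` (independent of `z, z'`
by irreducibility; we take `z = z' = 0`). -/
def rho (μ μ₀ : Zd d → ℝ) : ℝ :=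
  limsup (fun n : ℕ => (kerN μ μ₀ n 0 0) ^ ((n : ℝ)⁻¹)) atTop

/-- `μ` is a nonnegative measure on `ℤ^d` with `0 < μ(ℤ^d) ≤ 1`. -/
def IsMeasure (μ : Zd d → ℝ) : Prop := (∀ z, 0 ≤ μ z) ∧ 0 < ∑' z, μ z ∧ ∑' z, μ z ≤ 1

/-- (H0): `μ(x,y) = 0` for `y < -1` and `μ₀(x,y) = 0` for `y < 0`. -/
def H0 (μ μ₀ : Zd d → ℝ) : Prop :=
  (∀ z : Zd d, z.2 < -1 → μ z = 0) ∧ (∀ z : Zd d, z.2 < 0 → μ₀ z = 0)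

/-- (H1): the kernel `P` is irreducible on `E`. -/
def H1 (μ μ₀ : Zd d → ℝ) : Prop := ∀ z z' : Ed d, ∃ n, 0 < kerN μ μ₀ n z z'

/-- (H2): the homogeneous random walk with step distribution `μ` is irreducible on `ℤ^d`. -/
def H2 (μ : Zd d → ℝ) : Prop := ∀ z z' : Zd d, ∃ n, 0 < homN μ n z z'

/-- (H3) for a single measure: the jump generating function is finite everywhere
(the defining series converges for every `a ∈ ℝ^d`). -/
def H3 (μ : Zd d → ℝ) : Prop := ∀ a : Rd d, Summable fun z => μ z * Real.exp (dotZ a z)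

/-- (H4): the last coordinate of the `μ`-random walk is aperiodic
(the gcd of `{n : p^n(0,0) > 0}` equals `1`). -/
def H4 (μ : Zd d → ℝ) : Prop := ∀ m : ℕ, (∀ n : ℕ, 0 < lastN μ n 0 0 → m ∣ n) → m = 1

/-- The sublevel set `D^t = {a : φ(a) ≤ t}`. -/
def Dset (μ : Zd d → ℝ) (t : ℝ) : Set (Rd d) := {a | phi μ a ≤ t}

/-- `Θ^t = {α ∈ ℝ^{d-1} : inf_β max(φ(α,β), φ₀(α,β)) ≤ t}`. -/
def Theta (μ μ₀ : Zd d → ℝ) (t : ℝ) : Set (Fin d → ℝ) :=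
  {α | sInf (Set.range fun β : ℝ => max (phi μ (α, β)) (phi μ₀ (α, β))) ≤ t}

/-- `Ĥ^t = (Θ^t × ℝ) ∩ D^t`. -/
def Hhat (μ μ₀ : Zd d → ℝ) (t : ℝ) : Set (Rd d) :=
  {a | a.1 ∈ Theta μ μ₀ t ∧ phi μ a ≤ t}

/-- Partial derivative of `f : ℝ^d → ℝ` in the last coordinate. -/
def dBeta (f : Rd d → ℝ) (a : Rd d) : ℝ := fderiv ℝ f a (0, 1)

/-- The (coordinate) gradient of `f : ℝ^d → ℝ`. -/
def gradV (f : Rd d → ℝ) (a : Rd d) : Rd d :=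
  (fun i => fderiv ℝ f a (Pi.single i 1, 0), fderiv ℝ f a (0, 1))

/-- `∂₊D^t`: boundary points of `D^t` where the last coordinate of `∇φ` is `≥ 0`. -/
def dPlus (μ : Zd d → ℝ) (t : ℝ) : Set (Rd d) :=
  {a | a ∈ frontier (Dset μ t) ∧ 0 ≤ dBeta (phi μ) a}

/-- `∂₀D^t`: boundary points of `D^t` where the last coordinate of `∇φ` is `0`. -/
def dZero (μ : Zd d → ℝ) (t : ℝ) : Set (Rd d) :=
  {a | a ∈ frontier (Dset μ t) ∧ dBeta (phi μ) a = 0}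

/-- `Γ₊^t = Ĥ^t ∩ ∂₊D^t`. -/
def GammaPlus (μ μ₀ : Zd d → ℝ) (t : ℝ) : Set (Rd d) := Hhat μ μ₀ t ∩ dPlus μ t

/-- The normal cone `V_t(a)` to `Ĥ^t` at `a`. -/
def Vcone (μ μ₀ : Zd d → ℝ) (t : ℝ) (a : Rd d) : Set (Rd d) :=
  {q | ∀ a' ∈ Hhat μ μ₀ t, dotR q (a' - a) ≤ 0}

/-- `β̄ = min{b : φ(α,b) ≤ t}`. -/
def betaBar (μ : Zd d → ℝ) (t : ℝ) (α : Fin d → ℝ) : ℝ := sInf {b : ℝ | phi μ (α, b) ≤ t}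

/-- `ā^t`: the lowest point of `D^t` with the same first `d-1` coordinates as `a`. -/
def abar (μ : Zd d → ℝ) (t : ℝ) (a : Rd d) : Rd d := (a.1, betaBar μ t a.1)

/-- The Green function `G_t(z,z') = ∑_n t^{-n} p^(n)(z,z')`. -/
def green (μ μ₀ : Zd d → ℝ) (t : ℝ) (z z' : Ed d) : ℝ :=
  ∑' n, (t ^ n)⁻¹ * kerN μ μ₀ n z z'

/-- The `t`-Martin kernel `K_t(z,z') = G_t(z,z')/G_t(z₀,z')` with reference point `z₀`. -/
def martin (μ μ₀ : Zd d → ℝ) (t : ℝ) (z₀ z z' : Ed d) : ℝ :=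
  green μ μ₀ t z z' / green μ μ₀ t z₀ z'

/-- Euclidean norm on `ℝ^d = ℝ^{d-1} × ℝ`. -/
def euclNorm (a : Rd d) : ℝ := Real.sqrt ((∑ i, a.1 i ^ 2) + a.2 ^ 2)

/-- The point of `ℝ^d` corresponding to `z ∈ E`. -/
def vecE (z : Ed d) : Rd d := (fun i => (z.1 i : ℝ), (z.2 : ℝ))

/-- Euclidean distance from a point `v` to a set `S ⊆ ℝ^d`. -/
def distTo (S : Set (Rd d)) (v : Rd d) : ℝ := sInf ((fun q => euclNorm (v - q)) '' S)

/-- The function `h_{a,t}` of the paper. -/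
def hFun (μ μ₀ : Zd d → ℝ) (t : ℝ) (a : Rd d) (z : Ed d) : ℝ :=
  if a ∉ dZero μ t ∧ phi μ₀ (abar μ t a) < t then
    Real.exp (dotE a z)
      - ((t - phi μ₀ a) / (t - phi μ₀ (abar μ t a))) * Real.exp (dotE (abar μ t a) z)
  else if a = abar μ t a ∧ a ∈ dZero μ t ∧ phi μ₀ a < t then
    ((z.2 : ℝ) + dBeta (phi μ₀) a / (t - phi μ₀ a)) * Real.exp (dotE a z)
  else Real.exp (dotE (abar μ t a) z)


lemma ker_nonneg {μ μ₀ : Zd d → ℝ} (hμ : IsMeasure μ) (hμ₀ : IsMeasure μ₀) (z z' : Ed d) :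
    0 ≤ ker μ μ₀ z z' := by
  unfold ker
  split_ifs
  · exact hμ₀.1 _
  · exact hμ.1 _

lemma kerN_nonneg {μ μ₀ : Zd d → ℝ} (hμ : IsMeasure μ) (hμ₀ : IsMeasure μ₀) (n : ℕ) (z z' : Ed d) :
    0 ≤ kerN μ μ₀ n z z' := by
  induction n generalizing z' with
  | zero => simp only [kerN]; split_ifs <;> norm_num
  | succ n ih =>
    simp only [kerN]
    exact tsum_nonneg fun w => mul_nonneg (ih w) (ker_nonneg hμ hμ₀ _ _)

lemma homN_nonneg {μ : Zd d → ℝ} (hμ : IsMeasure μ) (n : ℕ) (z z' : Zd d) :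
    0 ≤ homN μ n z z' := by
  induction n generalizing z' with
  | zero => simp only [homN]; split_ifs <;> norm_num
  | succ n ih =>
    simp only [homN]
    exact tsum_nonneg fun w => mul_nonneg (ih w) (hμ.1 _)

/-- Edges of positive weight. -/
def Edge (μ μ₀ : Zd d → ℝ) (z z' : Ed d) : Prop := 0 < ker μ μ₀ z z'

lemma reach_of_pos {μ μ₀ : Zd d → ℝ} (hμ : IsMeasure μ) (hμ₀ : IsMeasure μ₀) (n : ℕ) (z z' : Ed d)
    (h : 0 < kerN μ μ₀ n z z') : Relation.ReflTransGen (Edge μ μ₀) z z' := by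
  induction n generalizing z' with
  | zero =>
    simp only [kerN] at h
    split_ifs at h with h'
    · subst h'; exact .refl
    · simp at h
  | succ n ih =>
    simp only [kerN] at h
    by_contra hc
    have : ∀ w, kerN μ μ₀ n z w * ker μ μ₀ w z' = 0 := by
      intro w
      by_contra hne
      have h1 : kerN μ μ₀ n z w ≠ 0 := left_ne_zero_of_mul hne
      have h2 : ker μ μ₀ w z' ≠ 0 := right_ne_zero_of_mul hne
      exact hc ((ih w ((kerN_nonneg hμ hμ₀ _ _ _).lt_of_ne' h1)).tail
        ((ker_nonneg hμ hμ₀ _ _).lt_of_ne' h2))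
    simp [this] at h

lemma exists_down {μ μ₀ : Zd d → ℝ} (hμ : IsMeasure μ) (h0 : H0 μ μ₀) (h2 : H2 μ) :
    ∃ x, 0 < μ (x, -1) := by
  by_contra! hc
  have hz : ∀ v : Zd d, v.2 < 0 → μ v = 0 := by
    intro v hv
    by_cases h : v.2 < -1
    · exact h0.1 v h
    · have : v = (v.1, -1) := Prod.ext rfl (by simp; omega)
      rw [this]
      exact le_antisymm (hc _) (hμ.1 _)
  have key : ∀ n (z z' : Zd d), 0 < homN μ n z z' → z.2 ≤ z'.2 := by
    intro n
    induction n with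
    | zero =>
      intro z z' h
      simp only [homN] at h
      split_ifs at h with h'
      · rw [h']
      · simp at h
    | succ n ih =>
      intro z z' h
      simp only [homN] at h
      by_contra hlt
      have : ∀ w, homN μ n z w * μ (z' - w) = 0 := by
        intro w
        by_contra hne
        have h1 := ih z w ((homN_nonneg hμ _ _ _).lt_of_ne' (left_ne_zero_of_mul hne))
        apply right_ne_zero_of_mul hne
        apply hz
        simp only [Prod.snd_sub]
        omega
      simp [this] at h
  obtain ⟨n, hn⟩ := h2 0 (0, -1)
  have := key n _ _ hn
  simp at this

/-! Upper bound -/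

lemma jump_inj (z : Ed d) : Function.Injective (jump z) := by
  intro a b h
  simp only [jump, Prod.mk.injEq, sub_left_inj, Nat.cast_inj] at h
  exact Prod.ext h.1 h.2

lemma dotE_jump (a : Rd d) (z z' : Ed d) : dotE a z' = dotE a z + dotZ a (jump z z') := by
  simp only [dotE, dotZ, jump, Pi.sub_apply]
  push_cast
  simp only [mul_sub, Finset.sum_sub_distrib]
  ring

lemma step_bound {μ μ₀ : Zd d → ℝ} (hμ : IsMeasure μ) (hμ₀ : IsMeasure μ₀)
    (h3 : H3 μ) (h3' : H3 μ₀) (a : Rd d) (w : Ed d) :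
    ∑' z', ENNReal.ofReal (ker μ μ₀ w z') * ENNReal.ofReal (Real.exp (dotE a z')) ≤
      ENNReal.ofReal (Real.exp (dotE a w)) * ENNReal.ofReal (max (phi μ a) (phi μ₀ a)) := by
  have gen : ∀ m : Zd d → ℝ, IsMeasure m → H3 m →
      ∑' z', ENNReal.ofReal (m (jump w z')) * ENNReal.ofReal (Real.exp (dotE a z')) ≤
      ENNReal.ofReal (Real.exp (dotE a w)) * ENNReal.ofReal (phi m a) := by
    intro m hm hm3
    unfold phi
    rw [ENNReal.ofReal_tsum_of_nonneg (fun z => mul_nonneg (hm.1 z) (Real.exp_pos _).le) (hm3 a),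
      ← ENNReal.tsum_mul_left]
    refine le_trans (le_of_eq ?_) (ENNReal.tsum_comp_le_tsum_of_injective (jump_inj w) _)
    congr 1
    ext z'
    rw [dotE_jump a w z', Real.exp_add, ENNReal.ofReal_mul (Real.exp_pos _).le,
      ENNReal.ofReal_mul (hm.1 _)]
    ring
  unfold ker
  split_ifs with h
  · exact (gen μ₀ hμ₀ h3').trans (by gcongr; exact le_max_right _ _)
  · exact (gen μ hμ h3).trans (by gcongr; exact le_max_left _ _)

lemma kerN_bound {μ μ₀ : Zd d → ℝ} (hμ : IsMeasure μ) (hμ₀ : IsMeasure μ₀)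
    (h3 : H3 μ) (h3' : H3 μ₀) (a : Rd d) (n : ℕ) (z : Ed d) :
    ∑' z', ENNReal.ofReal (kerN μ μ₀ n z z') * ENNReal.ofReal (Real.exp (dotE a z')) ≤
      ENNReal.ofReal (Real.exp (dotE a z)) * ENNReal.ofReal (max (phi μ a) (phi μ₀ a)) ^ n := by
  induction n with
  | zero =>
    rw [tsum_eq_single z]
    · simp [kerN]
    · intro b hb
      simp [kerN, hb.symm]
  | succ n ih =>
    have h1 : ∀ z', ENNReal.ofReal (kerN μ μ₀ (n+1) z z') ≤
        ∑' w, ENNReal.ofReal (kerN μ μ₀ n z w) * ENNReal.ofReal (ker μ μ₀ w z') := by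
      intro z'
      simp only [kerN]
      by_cases hs : Summable fun w => kerN μ μ₀ n z w * ker μ μ₀ w z'
      · rw [ENNReal.ofReal_tsum_of_nonneg (fun w => mul_nonneg (kerN_nonneg hμ hμ₀ _ _ _)
          (ker_nonneg hμ hμ₀ _ _)) hs]
        refine le_of_eq (tsum_congr fun w => ?_)
        rw [ENNReal.ofReal_mul (kerN_nonneg hμ hμ₀ _ _ _)]
      · rw [tsum_eq_zero_of_not_summable hs]; simp
    calc _ ≤ ∑' z', ∑' w, ENNReal.ofReal (kerN μ μ₀ n z w) *
          (ENNReal.ofReal (ker μ μ₀ w z') * ENNReal.ofReal (Real.exp (dotE a z'))) := by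
          refine ENNReal.tsum_le_tsum fun z' => ?_
          refine (mul_le_mul_left (h1 z') _).trans (le_of_eq ?_)
          rw [← ENNReal.tsum_mul_right]
          simp only [mul_assoc]
      _ = ∑' w, ENNReal.ofReal (kerN μ μ₀ n z w) *
          ∑' z', (ENNReal.ofReal (ker μ μ₀ w z') * ENNReal.ofReal (Real.exp (dotE a z'))) := by
          rw [ENNReal.tsum_comm]
          simp only [ENNReal.tsum_mul_left]
      _ ≤ ∑' w, ENNReal.ofReal (kerN μ μ₀ n z w) *
          (ENNReal.ofReal (Real.exp (dotE a w)) * ENNReal.ofReal (max (phi μ a) (phi μ₀ a))) := by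
          refine ENNReal.tsum_le_tsum fun w => ?_
          gcongr
          exact step_bound hμ hμ₀ h3 h3' a w
      _ = (∑' w, ENNReal.ofReal (kerN μ μ₀ n z w) * ENNReal.ofReal (Real.exp (dotE a w))) *
            ENNReal.ofReal (max (phi μ a) (phi μ₀ a)) := by
          rw [← ENNReal.tsum_mul_right]
          simp only [mul_assoc]
      _ ≤ _ := by
          refine (mul_le_mul_left ih _).trans (le_of_eq ?_)
          rw [pow_succ]; ring

lemma phi_nonneg {μ : Zd d → ℝ} (hμ : IsMeasure μ) (a : Rd d) : 0 ≤ phi μ a :=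
  tsum_nonneg fun z => mul_nonneg (hμ.1 z) (Real.exp_pos _).le

lemma kerN_zero_le {μ μ₀ : Zd d → ℝ} (hμ : IsMeasure μ) (hμ₀ : IsMeasure μ₀)
    (h3 : H3 μ) (h3' : H3 μ₀) (a : Rd d) (n : ℕ) :
    kerN μ μ₀ n 0 0 ≤ max (phi μ a) (phi μ₀ a) ^ n := by
  have hT : 0 ≤ max (phi μ a) (phi μ₀ a) := le_max_of_le_left (phi_nonneg hμ a)
  have h := (ENNReal.le_tsum (0 : Ed d)).trans (kerN_bound hμ hμ₀ h3 h3' a n 0)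
  have hd : dotE a (0 : Ed d) = 0 := by simp [dotE]
  rw [hd] at h
  simp only [Real.exp_zero, ENNReal.ofReal_one, mul_one, one_mul] at h
  rw [← ENNReal.ofReal_pow hT] at h
  exact (ENNReal.ofReal_le_ofReal_iff (pow_nonneg hT _)).1 h

lemma root_le {μ μ₀ : Zd d → ℝ} (hμ : IsMeasure μ) (hμ₀ : IsMeasure μ₀)
    (h3 : H3 μ) (h3' : H3 μ₀) (a : Rd d) (n : ℕ) (hn : n ≠ 0) :
    (kerN μ μ₀ n 0 0) ^ ((n : ℝ)⁻¹) ≤ max (phi μ a) (phi μ₀ a) := by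
  have hT : 0 ≤ max (phi μ a) (phi μ₀ a) := le_max_of_le_left (phi_nonneg hμ a)
  calc _ ≤ (max (phi μ a) (phi μ₀ a) ^ n) ^ ((n : ℝ)⁻¹) :=
        Real.rpow_le_rpow (kerN_nonneg hμ hμ₀ _ _ _) (kerN_zero_le hμ hμ₀ h3 h3' a n) (by positivity)
    _ = _ := Real.pow_rpow_inv_natCast hT hn

lemma kerN_summable {μ μ₀ : Zd d → ℝ} (hμ : IsMeasure μ) (hμ₀ : IsMeasure μ₀)
    (h3 : H3 μ) (h3' : H3 μ₀) (n : ℕ) (z : Ed d) : Summable (kerN μ μ₀ n z) := by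
  have h := kerN_bound hμ hμ₀ h3 h3' 0 n z
  have hd : ∀ z : Ed d, dotE (0 : Rd d) z = 0 := by simp [dotE]
  simp only [hd, Real.exp_zero, ENNReal.ofReal_one, mul_one, one_mul] at h
  have hne : ∑' z', ENNReal.ofReal (kerN μ μ₀ n z z') ≠ ⊤ :=
    ne_top_of_le_ne_top (ENNReal.pow_ne_top ENNReal.ofReal_ne_top) h
  have := ENNReal.summable_toReal hne
  simpa only [ENNReal.toReal_ofReal (kerN_nonneg hμ hμ₀ _ _ _)] using this

lemma summable_of_measure {μ : Zd d → ℝ} (hμ : IsMeasure μ) : Summable μ := by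
  by_contra h
  have := hμ.2.1
  rw [tsum_eq_zero_of_not_summable h] at this
  exact lt_irrefl _ this

lemma ker_le_one {μ μ₀ : Zd d → ℝ} (hμ : IsMeasure μ) (hμ₀ : IsMeasure μ₀) (z z' : Ed d) :
    ker μ μ₀ z z' ≤ 1 := by
  unfold ker
  split_ifs
  · exact ((summable_of_measure hμ₀).le_tsum _ (fun _ _ => hμ₀.1 _)).trans hμ₀.2.2
  · exact ((summable_of_measure hμ).le_tsum _ (fun _ _ => hμ.1 _)).trans hμ.2.2

lemma kerN_ker_summable {μ μ₀ : Zd d → ℝ} (hμ : IsMeasure μ) (hμ₀ : IsMeasure μ₀)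
    (h3 : H3 μ) (h3' : H3 μ₀) (n : ℕ) (z z' : Ed d) :
    Summable fun w => kerN μ μ₀ n z w * ker μ μ₀ w z' :=
  Summable.of_nonneg_of_le
    (fun w => mul_nonneg (kerN_nonneg hμ hμ₀ _ _ _) (ker_nonneg hμ hμ₀ _ _))
    (fun w => mul_le_of_le_one_right (kerN_nonneg hμ hμ₀ _ _ _) (ker_le_one hμ hμ₀ _ _))
    (kerN_summable hμ hμ₀ h3 h3' n z)

lemma kerN_mul_le {μ μ₀ : Zd d → ℝ} (hμ : IsMeasure μ) (hμ₀ : IsMeasure μ₀)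
    (h3 : H3 μ) (h3' : H3 μ₀) (m n : ℕ) (z w z' : Ed d) :
    kerN μ μ₀ m z w * kerN μ μ₀ n w z' ≤ kerN μ μ₀ (m + n) z z' := by
  induction n generalizing z' with
  | zero =>
    simp only [kerN, add_zero]
    split_ifs with h
    · simp [h]
    · simpa using kerN_nonneg hμ hμ₀ _ _ _
  | succ n ih =>
    rw [← add_assoc]
    simp only [kerN]
    rw [← tsum_mul_left]
    refine Summable.tsum_le_tsum (fun v => ?_)
      ((kerN_ker_summable hμ hμ₀ h3 h3' n w z').mul_left _)
      (kerN_ker_summable hμ hμ₀ h3 h3' (m + n) z z')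
    rw [← mul_assoc]
    exact mul_le_mul_of_nonneg_right (ih v) (ker_nonneg hμ hμ₀ _ _)

lemma kerN_first_le {μ μ₀ : Zd d → ℝ} (hμ : IsMeasure μ) (hμ₀ : IsMeasure μ₀)
    (h3 : H3 μ) (h3' : H3 μ₀) (n : ℕ) (z z' : Ed d) (S : Finset (Ed d)) :
    ∑ w ∈ S, ker μ μ₀ z w * kerN μ μ₀ n w z' ≤ kerN μ μ₀ (n + 1) z z' := by
  induction n generalizing z' with
  | zero =>
    have h1 : kerN μ μ₀ 1 z z' = ker μ μ₀ z z' := by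
      simp only [kerN]
      rw [tsum_eq_single z]
      · simp
      · intro b hb
        simp [hb.symm]
    rw [zero_add, h1]
    simp only [kerN, mul_ite, mul_one, mul_zero, Finset.sum_ite_eq']
    split_ifs
    · exact le_rfl
    · exact ker_nonneg hμ hμ₀ _ _
  | succ n ih =>
    have : ∑ w ∈ S, ker μ μ₀ z w * kerN μ μ₀ (n + 1) w z' =
        ∑' v, (∑ w ∈ S, ker μ μ₀ z w * kerN μ μ₀ n w v) * ker μ μ₀ v z' := by
      simp only [kerN, ← tsum_mul_left]
      rw [← Summable.tsum_finsetSum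
        (fun w _ => (kerN_ker_summable hμ hμ₀ h3 h3' n w z').mul_left _)]
      refine tsum_congr fun v => ?_
      rw [Finset.sum_mul]
      simp only [mul_assoc]
    rw [this]
    change _ ≤ ∑' v, kerN μ μ₀ (n + 1) z v * ker μ μ₀ v z'
    have hs := kerN_ker_summable hμ hμ₀ h3 h3' (n + 1) z z'
    have hle : ∀ v, (∑ w ∈ S, ker μ μ₀ z w * kerN μ μ₀ n w v) * ker μ μ₀ v z' ≤
        kerN μ μ₀ (n + 1) z v * ker μ μ₀ v z' :=
      fun v => mul_le_mul_of_nonneg_right (ih v) (ker_nonneg hμ hμ₀ _ _)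
    refine Summable.tsum_le_tsum hle (Summable.of_nonneg_of_le (fun v => ?_) hle hs) hs
    exact mul_nonneg (Finset.sum_nonneg fun w _ => mul_nonneg (ker_nonneg hμ hμ₀ _ _)
      (kerN_nonneg hμ hμ₀ _ _ _)) (ker_nonneg hμ hμ₀ _ _)

/-- `exp L` is a `t`-superharmonic function. -/
def SH (μ μ₀ : Zd d → ℝ) (t : ℝ) (L : Ed d → ℝ) : Prop :=
  ∀ (z : Ed d) (S : Finset (Ed d)), ∑ w ∈ S, ker μ μ₀ z w * Real.exp (L w - L z) ≤ t

lemma exists_SH {μ μ₀ : Zd d → ℝ} (hμ : IsMeasure μ) (hμ₀ : IsMeasure μ₀)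
    (h1 : H1 μ μ₀) (h3 : H3 μ) (h3' : H3 μ₀) (s t : ℝ) (hs : 0 < s) (hst : s < t)
    (hev : ∀ᶠ n in atTop, kerN μ μ₀ n 0 0 ≤ s ^ n) : ∃ L, SH μ μ₀ t L := by
  have ht : 0 < t := hs.trans hst
  have hsum : ∀ z, Summable fun n => (t ^ n)⁻¹ * kerN μ μ₀ n z 0 := by
    intro z
    obtain ⟨m, hm⟩ := h1 0 z
    have hg : Summable fun n : ℕ => s ^ m / kerN μ μ₀ m 0 z * (s / t) ^ n :=
      (summable_geometric_of_lt_one (by positivity) ((div_lt_one ht).2 hst)).mul_left _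
    refine hg.of_norm_bounded_eventually_nat ?_
    have hev' : ∀ᶠ n in atTop, kerN μ μ₀ (m + n) 0 0 ≤ s ^ (m + n) :=
      (tendsto_atTop_mono (fun n => Nat.le_add_left n m) tendsto_id).eventually hev
    filter_upwards [hev'] with n hn
    have h4 := (kerN_mul_le hμ hμ₀ h3 h3' m n 0 z 0).trans hn
    rw [Real.norm_of_nonneg (mul_nonneg (by positivity) (kerN_nonneg hμ hμ₀ _ _ _))]
    have h5 : kerN μ μ₀ n z 0 ≤ s ^ (m + n) / kerN μ μ₀ m 0 z := by
      rw [le_div_iff₀ hm, mul_comm]; exact h4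
    calc _ ≤ (t ^ n)⁻¹ * (s ^ (m + n) / kerN μ μ₀ m 0 z) := by gcongr
      _ = _ := by rw [pow_add, div_pow]; field_simp
  have hnn : ∀ z n, 0 ≤ (t ^ n)⁻¹ * kerN μ μ₀ n z 0 := fun z n =>
    mul_nonneg (by positivity) (kerN_nonneg hμ hμ₀ _ _ _)
  set G : Ed d → ℝ := fun z => ∑' n, (t ^ n)⁻¹ * kerN μ μ₀ n z 0 with hG
  have hpos : ∀ z, 0 < G z := by
    intro z
    obtain ⟨n, hn⟩ := h1 z 0
    exact (hsum z).tsum_pos (hnn z) n (by positivity)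
  refine ⟨fun z => Real.log (G z), fun z S => ?_⟩
  have hmain : ∑ w ∈ S, ker μ μ₀ z w * G w ≤ t * G z := by
    have e1 : ∑ w ∈ S, ker μ μ₀ z w * G w =
        ∑' n, (t ^ n)⁻¹ * ∑ w ∈ S, ker μ μ₀ z w * kerN μ μ₀ n w 0 := by
      simp only [hG, ← tsum_mul_left]
      rw [← Summable.tsum_finsetSum (fun w _ => (hsum w).mul_left _)]
      refine tsum_congr fun n => ?_
      rw [Finset.mul_sum]
      exact Finset.sum_congr rfl fun w _ => by ring
    have hs1 : Summable fun n => (t ^ (n+1))⁻¹ * kerN μ μ₀ (n+1) z 0 :=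
      (summable_nat_add_iff 1).2 (hsum z)
    have e2 : ∑' n, (t ^ (n+1))⁻¹ * kerN μ μ₀ (n+1) z 0 ≤ G z := by
      rw [hG]
      simp only
      rw [(hsum z).tsum_eq_zero_add]
      exact le_add_of_nonneg_left (hnn z 0)
    have hle : ∀ n : ℕ, (t ^ n)⁻¹ * ∑ w ∈ S, ker μ μ₀ z w * kerN μ μ₀ n w 0 ≤
        t * ((t ^ (n+1))⁻¹ * kerN μ μ₀ (n+1) z 0) := by
      intro n
      have : t * ((t ^ (n+1))⁻¹ * kerN μ μ₀ (n+1) z 0) = (t ^ n)⁻¹ * kerN μ μ₀ (n+1) z 0 := by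
        rw [pow_succ]; field_simp
      rw [this]
      have := kerN_first_le hμ hμ₀ h3 h3' n z 0 S
      gcongr
    rw [e1]
    calc _ ≤ ∑' n, t * ((t ^ (n+1))⁻¹ * kerN μ μ₀ (n+1) z 0) := by
          refine Summable.tsum_le_tsum hle (Summable.of_nonneg_of_le (fun n => ?_) hle
            (hs1.mul_left t)) (hs1.mul_left t)
          exact mul_nonneg (by positivity) (Finset.sum_nonneg fun w _ =>
            mul_nonneg (ker_nonneg hμ hμ₀ _ _) (kerN_nonneg hμ hμ₀ _ _ _))
      _ = t * ∑' n, ((t ^ (n+1))⁻¹ * kerN μ μ₀ (n+1) z 0) := tsum_mul_left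
      _ ≤ _ := by gcongr
  have : ∑ w ∈ S, ker μ μ₀ z w * Real.exp (Real.log (G w) - Real.log (G z)) =
      (∑ w ∈ S, ker μ μ₀ z w * G w) / G z := by
    rw [Finset.sum_div]
    refine Finset.sum_congr rfl fun w _ => ?_
    rw [Real.exp_sub, Real.exp_log (hpos _), Real.exp_log (hpos _), mul_div_assoc]
  rw [this, div_le_iff₀ (hpos z)]
  exact hmain

/-- horizontal translation -/
def sh (x : Fin d → ℤ) (z : Ed d) : Ed d := (z.1 + x, z.2)

lemma ker_sh (μ μ₀ : Zd d → ℝ) (x : Fin d → ℤ) (z z' : Ed d) :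
    ker μ μ₀ (sh x z) (sh x z') = ker μ μ₀ z z' := by
  simp [ker, sh, jump]

lemma sh_inj (x : Fin d → ℤ) : Function.Injective (sh x : Ed d → Ed d) := by
  intro a b h
  simp only [sh, Prod.mk.injEq, add_left_inj] at h
  exact Prod.ext h.1 h.2

lemma sh_sh (x y : Fin d → ℤ) (z : Ed d) : sh x (sh y z) = sh (x + y) z := by
  simp only [sh, Prod.mk.injEq, and_true]; abel

lemma sh_zero (z : Ed d) : sh 0 z = z := by simp [sh]

lemma SH.edge {μ μ₀ : Zd d → ℝ} {t : ℝ} {L : Ed d → ℝ} (h : SH μ μ₀ t L) (z z' : Ed d)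
    (hp : 0 < ker μ μ₀ z z') : L z' - L z ≤ Real.log (t / ker μ μ₀ z z') := by
  have h1 := h z {z'}
  rw [Finset.sum_singleton, mul_comm, ← le_div_iff₀ hp] at h1
  exact (Real.le_log_iff_exp_le ((Real.exp_pos _).trans_le h1)).2 h1

lemma SH.harnack_one {μ μ₀ : Zd d → ℝ} {t : ℝ} {L : Ed d → ℝ} (h : SH μ μ₀ t L) (z z' : Ed d)
    (hr : Relation.ReflTransGen (Edge μ μ₀) z z') :
    ∃ C, ∀ x, L (sh x z') - L (sh x z) ≤ C := by
  induction hr with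
  | refl => exact ⟨0, fun x => by simp⟩
  | @tail b c _ hbc ih =>
    obtain ⟨C, hC⟩ := ih
    refine ⟨C + Real.log (t / ker μ μ₀ b c), fun x => ?_⟩
    have := h.edge (sh x b) (sh x c) (by rw [ker_sh]; exact hbc)
    rw [ker_sh] at this
    linarith [hC x]

lemma SH.harnack {μ μ₀ : Zd d → ℝ} (hμ : IsMeasure μ) (hμ₀ : IsMeasure μ₀)
    (h1 : H1 μ μ₀) {t : ℝ} {L : Ed d → ℝ} (h : SH μ μ₀ t L) (z : Ed d) :
    ∃ C, ∀ x, |L (sh x z) - L (sh x 0)| ≤ C := by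
  obtain ⟨n, hn⟩ := h1 0 z
  obtain ⟨m, hm⟩ := h1 z 0
  obtain ⟨C, hC⟩ := h.harnack_one _ _ (reach_of_pos hμ hμ₀ _ _ _ hn)
  obtain ⟨D, hD⟩ := h.harnack_one _ _ (reach_of_pos hμ hμ₀ _ _ _ hm)
  refine ⟨max C D, fun x => ?_⟩
  rw [abs_le]
  constructor
  · linarith [hD x, le_max_right C D]
  · linarith [hC x, le_max_left C D]

lemma bounded_ulim (u : ℕ → ℝ) (C : ℝ) (h : ∀ n, |u n| ≤ C) :
    ∃ l, Tendsto u (hyperfilter ℕ) (nhds l) := by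
  have hc : IsCompact (Set.Icc (-C) C) := isCompact_Icc
  obtain ⟨l, _, hl⟩ := hc.ultrafilter_le_nhds ((hyperfilter ℕ).map u) (by
    rw [le_principal_iff]
    exact Filter.mem_map.2 (Filter.univ_mem' fun n => abs_le.1 (h n)))
  exact ⟨l, hl⟩

/-- Cesaro average. -/
def avg (L : Ed d → ℝ) (e : Fin d → ℤ) (N : ℕ) (z : Ed d) : ℝ :=
  ∑ k ∈ Finset.range (N + 1), ((N : ℝ) + 1)⁻¹ *
    (L (sh ((k : ℤ) • e) z) - L (sh ((k : ℤ) • e) 0))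

lemma wsum (N : ℕ) (c : ℝ) : ∑ _k ∈ Finset.range (N + 1), ((N : ℝ) + 1)⁻¹ * c = c := by
  rw [Finset.sum_const, Finset.card_range, nsmul_eq_mul]
  push_cast
  have : (N : ℝ) + 1 ≠ 0 := by positivity
  field_simp

lemma avg_abs_le (L : Ed d → ℝ) (e : Fin d → ℤ) (N : ℕ) (z : Ed d) (C : ℝ)
    (hC : ∀ x, |L (sh x z) - L (sh x 0)| ≤ C) : |avg L e N z| ≤ C := by
  refine (Finset.abs_sum_le_sum_abs _ _).trans ?_
  rw [← wsum N C]
  refine Finset.sum_le_sum fun k _ => ?_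
  rw [abs_mul, abs_of_nonneg (by positivity : 0 ≤ ((N : ℝ) + 1)⁻¹)]
  exact mul_le_mul_of_nonneg_left (hC _) (by positivity)

lemma avg_SH {μ μ₀ : Zd d → ℝ} (hμ : IsMeasure μ) (hμ₀ : IsMeasure μ₀)
    {t : ℝ} {L : Ed d → ℝ} (h : SH μ μ₀ t L) (e : Fin d → ℤ) (N : ℕ) :
    SH μ μ₀ t (avg L e N) := by
  intro z S
  have hexp : ∀ w, Real.exp (avg L e N w - avg L e N z) ≤
      ∑ k ∈ Finset.range (N + 1), ((N : ℝ) + 1)⁻¹ *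
        Real.exp (L (sh ((k : ℤ) • e) w) - L (sh ((k : ℤ) • e) z)) := by
    intro w
    have e1 : avg L e N w - avg L e N z = ∑ k ∈ Finset.range (N + 1), ((N : ℝ) + 1)⁻¹ •
        (L (sh ((k : ℤ) • e) w) - L (sh ((k : ℤ) • e) z)) := by
      simp only [avg, smul_eq_mul]
      rw [← Finset.sum_sub_distrib]
      exact Finset.sum_congr rfl fun k _ => by ring
    rw [e1]
    refine (convexOn_exp.map_sum_le (fun k _ => by positivity) ?_ (fun _ _ => Set.mem_univ _)).trans
      (le_of_eq ?_)
    · simpa using wsum N 1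
    · simp only [smul_eq_mul]
  calc _ ≤ ∑ w ∈ S, ker μ μ₀ z w * ∑ k ∈ Finset.range (N + 1), ((N : ℝ) + 1)⁻¹ *
        Real.exp (L (sh ((k : ℤ) • e) w) - L (sh ((k : ℤ) • e) z)) :=
        Finset.sum_le_sum fun w _ => mul_le_mul_of_nonneg_left (hexp w) (ker_nonneg hμ hμ₀ _ _)
    _ = ∑ k ∈ Finset.range (N + 1), ((N : ℝ) + 1)⁻¹ * ∑ w ∈ S, ker μ μ₀ z w *
        Real.exp (L (sh ((k : ℤ) • e) w) - L (sh ((k : ℤ) • e) z)) := by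
        simp only [Finset.mul_sum]
        rw [Finset.sum_comm]
        exact Finset.sum_congr rfl fun k _ => Finset.sum_congr rfl fun w _ => by ring
    _ ≤ ∑ _k ∈ Finset.range (N + 1), ((N : ℝ) + 1)⁻¹ * t := by
        refine Finset.sum_le_sum fun k _ => mul_le_mul_of_nonneg_left ?_ (by positivity)
        have := h (sh ((k : ℤ) • e) z) (S.image (sh ((k : ℤ) • e)))
        rw [Finset.sum_image (fun a _ b _ hab => sh_inj _ hab)] at this
        simpa only [ker_sh] using this
    _ = t := wsum N t

lemma avg_tele (L : Ed d → ℝ) (e : Fin d → ℤ) (N : ℕ) (z : Ed d) :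
    avg L e N (sh e z) - avg L e N z =
      ((N : ℝ) + 1)⁻¹ * (L (sh (((N + 1 : ℕ) : ℤ) • e) z) - L z) := by
  have : avg L e N (sh e z) - avg L e N z = ∑ k ∈ Finset.range (N + 1), ((N : ℝ) + 1)⁻¹ *
      (L (sh (((k + 1 : ℕ) : ℤ) • e) z) - L (sh ((k : ℤ) • e) z)) := by
    simp only [avg]
    rw [← Finset.sum_sub_distrib]
    refine Finset.sum_congr rfl fun k _ => ?_
    rw [sh_sh]
    have : (k : ℤ) • e + e = ((k + 1 : ℕ) : ℤ) • e := by push_cast; rw [add_smul, one_smul]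
    rw [this]; ring
  rw [this, ← Finset.mul_sum, Finset.sum_range_sub (fun k : ℕ => L (sh ((k : ℤ) • e) z))]
  simp [sh_zero]

lemma SH.average {μ μ₀ : Zd d → ℝ} (hμ : IsMeasure μ) (hμ₀ : IsMeasure μ₀)
    (h1 : H1 μ μ₀) {t : ℝ} {L : Ed d → ℝ} (h : SH μ μ₀ t L) (e : Fin d → ℤ) :
    ∃ L', SH μ μ₀ t L' ∧ (∃ c, ∀ z, L' (sh e z) = L' z + c) ∧
      ∀ x c, (∀ z, L (sh x z) = L z + c) → ∀ z, L' (sh x z) = L' z + c := by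
  choose C hC using fun z => h.harnack hμ hμ₀ h1 z
  choose L' hL' using fun z =>
    bounded_ulim (fun N => avg L e N z) (C z) (fun N => avg_abs_le L e N z (C z) (hC z))
  refine ⟨L', ?_, ⟨L' (sh e 0) - L' 0, ?_⟩, ?_⟩
  · intro z S
    have ht : Tendsto (fun N => ∑ w ∈ S, ker μ μ₀ z w * Real.exp (avg L e N w - avg L e N z))
        (hyperfilter ℕ) (nhds (∑ w ∈ S, ker μ μ₀ z w * Real.exp (L' w - L' z))) := by
      refine tendsto_finsetSum _ fun w _ => ?_
      exact (((Real.continuous_exp.tendsto _).comp ((hL' w).sub (hL' z)))).const_mul _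
    exact le_of_tendsto' ht fun N => avg_SH hμ hμ₀ h e N z S
  · intro z
    have ht := ((hL' (sh e z)).sub (hL' z)).sub ((hL' (sh e 0)).sub (hL' 0))
    have h0 : Tendsto (fun N => (avg L e N (sh e z) - avg L e N z) -
        (avg L e N (sh e 0) - avg L e N 0)) atTop (nhds 0) := by
      have hb : Tendsto (fun N : ℕ => (2 * C z) * (1 / ((N : ℝ) + 1))) atTop (nhds 0) := by
        simpa using (tendsto_one_div_add_atTop_nhds_zero_nat (𝕜 := ℝ)).const_mul (2 * C z)
      refine squeeze_zero_norm (fun N => ?_) hb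
      rw [avg_tele, avg_tele, ← mul_sub, norm_mul, Real.norm_of_nonneg (by positivity), mul_comm,
        one_div, Real.norm_eq_abs]
      refine mul_le_mul_of_nonneg_right ?_ (by positivity)
      have a1 := abs_le.1 (hC z (((N + 1 : ℕ) : ℤ) • e))
      have a2 := abs_le.1 (hC z 0)
      simp only [sh_zero] at a2
      rw [abs_le]
      constructor <;> linarith [a1.1, a1.2, a2.1, a2.2]
    have h0' := h0.mono_left Nat.hyperfilter_le_atTop
    have := tendsto_nhds_unique ht h0'
    linarith
  · intro x c hx z
    have ha : ∀ N, avg L e N (sh x z) = avg L e N z + c := by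
      intro N
      conv_rhs => rw [← wsum N c]
      simp only [avg]
      rw [← Finset.sum_add_distrib]
      refine Finset.sum_congr rfl fun k _ => ?_
      rw [sh_sh, add_comm ((k : ℤ) • e) x, ← sh_sh, hx]
      ring
    have ht := hL' (sh x z)
    simp only [ha] at ht
    exact tendsto_nhds_unique ht ((hL' z).add_const c)

lemma exists_SH_inv {μ μ₀ : Zd d → ℝ} (hμ : IsMeasure μ) (hμ₀ : IsMeasure μ₀)
    (h1 : H1 μ μ₀) {t : ℝ} {L : Ed d → ℝ} (h : SH μ μ₀ t L) (s : Finset (Fin d)) :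
    ∃ L', SH μ μ₀ t L' ∧ ∀ i ∈ s, ∃ c, ∀ z, L' (sh (Pi.single i 1) z) = L' z + c := by
  induction s using Finset.induction_on with
  | empty => exact ⟨L, h, by simp⟩
  | insert i s _ ih =>
    obtain ⟨L1, hL1, hs⟩ := ih
    obtain ⟨L2, hL2, hi, hx⟩ := hL1.average hμ hμ₀ h1 (Pi.single i 1)
    refine ⟨L2, hL2, fun j hj => ?_⟩
    rcases Finset.mem_insert.1 hj with rfl | hj
    · exact hi
    · obtain ⟨c, hc⟩ := hs j hj
      exact ⟨c, hx _ c hc⟩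

lemma shift_int (L : Ed d → ℝ) (e : Fin d → ℤ) (c : ℝ) (hc : ∀ z, L (sh e z) = L z + c)
    (n : ℤ) (z : Ed d) : L (sh (n • e) z) = L z + n * c := by
  induction n using Int.induction_on with
  | zero => simp [sh_zero]
  | succ n ih =>
    have : ((n : ℤ) + 1) • e = e + (n : ℤ) • e := by rw [add_smul, one_smul, add_comm]
    rw [this, ← sh_sh, hc, ih]; push_cast; ring
  | pred n ih =>
    have : (-(n : ℤ)) • e = e + (-(n : ℤ) - 1) • e := by rw [sub_smul, one_smul]; abel
    rw [this, ← sh_sh, hc] at ih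
    push_cast at ih ⊢
    linarith

lemma shift_all (L : Ed d → ℝ) (c : Fin d → ℝ)
    (hc : ∀ i z, L (sh (Pi.single i 1) z) = L z + c i) (x : Fin d → ℤ) (z : Ed d) :
    L (sh x z) = L z + ∑ i, c i * (x i : ℝ) := by
  have key : ∀ s : Finset (Fin d), L (sh (∑ i ∈ s, x i • Pi.single i (1 : ℤ)) z) =
      L z + ∑ i ∈ s, c i * (x i : ℝ) := by
    intro s
    induction s using Finset.induction_on with
    | empty => simp [sh_zero]
    | insert i s hi ih =>
      rw [Finset.sum_insert hi, Finset.sum_insert hi, ← sh_sh, shift_int L _ _ (hc i), ih]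
      ring
  have hx : ∑ i, x i • Pi.single i (1 : ℤ) = x := by
    ext j
    simp [Finset.sum_apply, Pi.single_apply]
  rw [← key Finset.univ, hx]

/-- adding an element of `ℤ^d` to a point of `E`. -/
def addv (z : Ed d) (v : Zd d) : Ed d := (z.1 + v.1, ((z.2 : ℤ) + v.2).toNat)

lemma SH.sum_le {μ μ₀ : Zd d → ℝ} {t : ℝ} {L : Ed d → ℝ} (h : SH μ μ₀ t L) (z : Ed d)
    (S : Finset (Zd d)) (hS : ∀ v ∈ S, 0 ≤ (z.2 : ℤ) + v.2) :
    ∑ v ∈ S, (if z.2 = 0 then μ₀ v else μ v) * Real.exp (L (addv z v) - L z) ≤ t := by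
  have hinj : Set.InjOn (addv z) S := by
    intro a ha b hb hab
    have h1 := hS a ha
    have h2 := hS b hb
    simp only [addv, Prod.mk.injEq, add_right_inj] at hab
    exact Prod.ext hab.1 (by have := hab.2; omega)
  have := h z (S.image (addv z))
  rw [Finset.sum_image hinj] at this
  refine le_trans (le_of_eq (Finset.sum_congr rfl fun v hv => ?_)) this
  have hj : jump z (addv z v) = v := by
    have h1 := hS v hv
    refine Prod.ext ?_ ?_
    · simp [jump, addv]
    · simp only [jump, addv]; omega
  simp only [ker, hj]

lemma exists_point {μ μ₀ : Zd d → ℝ} (hμ : IsMeasure μ) (hμ₀ : IsMeasure μ₀)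
    (h0 : H0 μ μ₀) (h1 : H1 μ μ₀) (h2 : H2 μ) (h3 : H3 μ) (h3' : H3 μ₀)
    {t : ℝ} {L₀ : Ed d → ℝ} (hL₀ : SH μ μ₀ t L₀) :
    ∃ a : Rd d, phi μ a ≤ t ∧ phi μ₀ a ≤ t := by
  obtain ⟨L, hL, hinv⟩ := exists_SH_inv hμ hμ₀ h1 hL₀ Finset.univ
  choose c hc using fun i => hinv i (Finset.mem_univ i)
  have hsplit : ∀ (x : Fin d → ℤ) (y : ℕ), L (x, y) = L (0, y) + ∑ i, c i * (x i : ℝ) := by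
    intro x y
    have := shift_all L c hc x (0, y)
    simpa [sh] using this
  set ℓ : ℕ → ℝ := fun y => L (0, y) with hℓ
  -- lower bound for increments
  obtain ⟨x₀, hx₀⟩ := exists_down hμ h0 h2
  have hbdd : BddBelow (Set.range fun y => ℓ (y + 1) - ℓ y) := by
    refine ⟨(∑ i, c i * (x₀ i : ℝ)) - Real.log (t / μ (x₀, -1)), ?_⟩
    rintro _ ⟨y, rfl⟩
    have hk : ker μ μ₀ ((0 : Fin d → ℤ), y + 1) (x₀, y) = μ (x₀, -1) := by
      simp [ker, jump]
    have := hL.edge ((0 : Fin d → ℤ), y + 1) (x₀, y) (by rw [hk]; exact hx₀)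
    rw [hk, hsplit x₀ y] at this
    simp only [hℓ]
    linarith
  set β : ℝ := sInf (Set.range fun y => ℓ (y + 1) - ℓ y) with hβ
  have hinc : ∀ y, β ≤ ℓ (y + 1) - ℓ y := fun y => csInf_le hbdd ⟨y, rfl⟩
  have hincs : ∀ y k : ℕ, β * k ≤ ℓ (y + k) - ℓ y := by
    intro y k
    induction k with
    | zero => simp
    | succ k ih =>
      have := hinc (y + k)
      rw [← add_assoc]
      push_cast
      linarith
  have hdot : ∀ v : Zd d, dotZ ((c, β) : Rd d) v = (∑ i, c i * (v.1 i : ℝ)) + β * v.2 :=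
    fun v => rfl
  have haddv : ∀ (y : ℕ) (v : Zd d), L (addv (0, y) v) - L (0, y) =
      ℓ (((y : ℤ) + v.2).toNat) - ℓ y + ∑ i, c i * (v.1 i : ℝ) := by
    intro y v
    simp only [addv, zero_add]
    rw [hsplit]
    ring
  refine ⟨(c, β), ?_, ?_⟩
  · refine (h3 (c, β)).tsum_le_of_sum_le fun S => ?_
    have hε : ∀ ε : ℝ, 0 < ε → Real.exp (-ε) * ∑ v ∈ S, μ v * Real.exp (dotZ (c, β) v) ≤ t := by
      intro ε hε
      obtain ⟨_, ⟨y, rfl⟩, hy⟩ := Real.lt_sInf_add_pos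
        (Set.range_nonempty fun y => ℓ (y + 1) - ℓ y) hε
      have hs := hL.sum_le ((0 : Fin d → ℤ), y + 1) (S.filter fun v => -1 ≤ v.2) (by
        intro v hv
        have := (Finset.mem_filter.1 hv).2
        push_cast
        omega)
      refine le_trans ?_ hs
      have hf : ∑ v ∈ S, μ v * Real.exp (dotZ (c, β) v) =
          ∑ v ∈ S.filter (fun v => -1 ≤ v.2), μ v * Real.exp (dotZ (c, β) v) := by
        symm
        refine Finset.sum_filter_of_ne fun v _ hne => ?_
        by_contra hlt
        exact hne (by rw [h0.1 v (by omega), zero_mul])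
      rw [hf, Finset.mul_sum]
      refine Finset.sum_le_sum fun v hv => ?_
      have hv2 := (Finset.mem_filter.1 hv).2
      rw [if_neg (Nat.succ_ne_zero y), mul_left_comm, ← Real.exp_add]
      refine mul_le_mul_of_nonneg_left (Real.exp_le_exp.2 ?_) (hμ.1 v)
      rw [haddv, hdot]
      rcases hv2.eq_or_lt with he | hlt
      · have e1 : (((y + 1 : ℕ) : ℤ) + v.2).toNat = y := by rw [← he]; push_cast; omega
        rw [e1, ← he]
        push_cast
        simp only at hy
        linarith
      · obtain ⟨k, hk⟩ := Int.eq_ofNat_of_zero_le (by omega : 0 ≤ v.2)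
        have e1 : (((y + 1 : ℕ) : ℤ) + v.2).toNat = (y + 1) + k := by rw [hk]; omega
        rw [e1, hk]
        have := hincs (y + 1) k
        push_cast
        linarith
    have hlim : Tendsto (fun ε : ℝ => Real.exp (-ε) * ∑ v ∈ S, μ v * Real.exp (dotZ (c, β) v))
        (nhdsWithin 0 (Set.Ioi 0)) (nhds (Real.exp (-0) *
          ∑ v ∈ S, μ v * Real.exp (dotZ (c, β) v))) := by
      refine Tendsto.mono_left ?_ nhdsWithin_le_nhds
      exact Continuous.tendsto (by fun_prop) 0
    have := le_of_tendsto hlim (by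
      filter_upwards [self_mem_nhdsWithin] with ε h using hε ε h)
    simpa using this
  · refine (h3' (c, β)).tsum_le_of_sum_le fun S => ?_
    have hs := hL.sum_le ((0 : Fin d → ℤ), 0) (S.filter fun v => 0 ≤ v.2) (by
      intro v hv
      have := (Finset.mem_filter.1 hv).2
      simpa using this)
    refine le_trans ?_ hs
    have hf : ∑ v ∈ S, μ₀ v * Real.exp (dotZ (c, β) v) =
        ∑ v ∈ S.filter (fun v => 0 ≤ v.2), μ₀ v * Real.exp (dotZ (c, β) v) := by
      symm
      refine Finset.sum_filter_of_ne fun v _ hne => ?_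
      by_contra hlt
      exact hne (by rw [h0.2 v (by omega), zero_mul])
    rw [hf]
    refine Finset.sum_le_sum fun v hv => ?_
    have hv2 := (Finset.mem_filter.1 hv).2
    rw [if_pos rfl]
    refine mul_le_mul_of_nonneg_left (Real.exp_le_exp.2 ?_) (hμ₀.1 v)
    rw [haddv, hdot]
    obtain ⟨k, hk⟩ := Int.eq_ofNat_of_zero_le hv2
    have e1 : (((0 : ℕ) : ℤ) + v.2).toNat = 0 + k := by rw [hk]; omega
    rw [e1, hk]
    have := hincs 0 k
    push_cast
    linarith

/-- Proposition 1: under (H0)-(H3), the convergence norm of the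
transition kernel `P` equals `inf_{a ∈ ℝ^d} max(φ(a), φ₀(a))`. -/
theorem convergence_norm_eq {d : ℕ} (μ μ₀ : Zd d → ℝ)
    (hμ : IsMeasure μ) (hμ₀ : IsMeasure μ₀)
    (h0 : H0 μ μ₀) (h1 : H1 μ μ₀) (h2 : H2 μ) (h3 : H3 μ) (h3' : H3 μ₀) :
    rho μ μ₀ = sInf (Set.range fun a : Rd d => max (phi μ a) (phi μ₀ a)) := by
  have hnn : ∀ n : ℕ, 0 ≤ (kerN μ μ₀ n 0 0) ^ ((n : ℝ)⁻¹) :=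
    fun n => Real.rpow_nonneg (kerN_nonneg hμ hμ₀ _ _ _) _
  have hub : ∀ a : Rd d, ∀ᶠ n : ℕ in atTop,
      (kerN μ μ₀ n 0 0) ^ ((n : ℝ)⁻¹) ≤ max (phi μ a) (phi μ₀ a) := by
    intro a
    filter_upwards [eventually_ne_atTop 0] with n hn using root_le hμ hμ₀ h3 h3' a n hn
  have hcob : IsCoboundedUnder (· ≤ ·) atTop
      (fun n : ℕ => (kerN μ μ₀ n 0 0) ^ ((n : ℝ)⁻¹)) :=
    (isBoundedUnder_of ⟨0, fun n => hnn n⟩ :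
      IsBoundedUnder (· ≥ ·) atTop _).isCoboundedUnder_le
  have hbd : IsBoundedUnder (· ≤ ·) atTop
      (fun n : ℕ => (kerN μ μ₀ n 0 0) ^ ((n : ℝ)⁻¹)) := ⟨_, eventually_map.2 (hub 0)⟩
  apply le_antisymm
  · refine le_csInf (Set.range_nonempty _) ?_
    rintro _ ⟨a, rfl⟩
    exact limsup_le_of_le hcob (hub a)
  · have hrho : 0 ≤ rho μ μ₀ :=
      le_limsup_of_frequently_le (Eventually.of_forall hnn).frequently hbd
    refine le_of_forall_gt_imp_ge_of_dense fun t ht => ?_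
    obtain ⟨s, hs1, hs2⟩ := exists_between ht
    have hs0 : 0 < s := hrho.trans_lt hs1
    have hev : ∀ᶠ n in atTop, kerN μ μ₀ n 0 0 ≤ s ^ n := by
      filter_upwards [eventually_lt_of_limsup_lt hs1 hbd, eventually_ne_atTop 0] with n hn hn0
      calc kerN μ μ₀ n 0 0 = ((kerN μ μ₀ n 0 0) ^ ((n : ℝ)⁻¹)) ^ n :=
            (Real.rpow_inv_natCast_pow (kerN_nonneg hμ hμ₀ _ _ _) hn0).symm
        _ ≤ s ^ n := pow_le_pow_left₀ (hnn n) hn.le n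
    obtain ⟨L, hL⟩ := exists_SH hμ hμ₀ h1 h3 h3' s t hs0 hs2 hev
    obtain ⟨a, ha, ha'⟩ := exists_point hμ hμ₀ h0 h1 h2 h3 h3' hL
    refine le_trans (csInf_le ⟨0, ?_⟩ (Set.mem_range_self a)) (max_le ha ha')
    rintro _ ⟨b, rfl⟩
    exact le_max_of_le_left (phi_nonneg hμ b)

end RWHalfspace
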